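/- arXiv:2005.09852 — 2 statements merged into one kernel-verified Lean document; each statement's English description precedes it below -/
import Mathlib

section
/- Let m be a non-negative integer. If complex numbers c_0, c_2, c_4, …, c_{2m} satisfy Z_{2m+1}(s) + c_{2m}·Z_{2m}(s) + c_{2m−2}·Z_{2m−2}(s) + ⋯ + c_2·Z_2(s) + c_0·Z_0(s)/2 = 0 for every complex number s with Re(s) > 2, then the coefficients c_0, c_2, …, c_{2m} are uniquely determined (any two tuples of complex numbers satisfying this identity coincide); moreover, if m ≥ 1 then necessarily c_{2m} = −(2m+1)/2. -/
/-- The Euler–Zagier double zeta function `ζ(-c, s+c) = ∑_{m,n ≥ 1} m^c / (m+n)^(s+c)`. -/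
noncomputable def Z (c : ℕ) (s : ℂ) : ℂ :=
  ∑' p : ℕ+ × ℕ+, ((p.1 : ℕ) : ℂ) ^ c / ((((p.1 : ℕ) + (p.2 : ℕ) : ℕ)) : ℂ) ^ (s + (c : ℂ))

open Finset in
/-- The `N`-th Dirichlet coefficient of `Z c`. -/
noncomputable def zCoeff (c N : ℕ) : ℂ := (∑ j ∈ Ico 1 N, (j : ℂ) ^ c) / (N : ℂ) ^ c

lemma norm_pow_div_add_cpow_le (c : ℕ) {s : ℂ} (hs : 0 < s.re) {x y : ℕ} (hx : 0 < x)
    (hy : 0 < y) :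
    ‖(x : ℂ) ^ c / ((x + y : ℕ) : ℂ) ^ (s + (c : ℂ))‖ ≤
      (x : ℝ) ^ (-(s.re / 2)) * (y : ℝ) ^ (-(s.re / 2)) := by
  have hx' : (0 : ℝ) < x := by exact_mod_cast hx
  have hy' : (0 : ℝ) < y := by exact_mod_cast hy
  have hxy : (0 : ℝ) < (x + y : ℕ) := by exact_mod_cast Nat.add_pos_left hx y
  rw [norm_div, norm_pow, Complex.norm_natCast, Complex.norm_natCast_cpow_of_pos (by lia),
    Complex.add_re, Complex.natCast_re, Real.rpow_add hxy, Real.rpow_natCast,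
    ← Real.mul_rpow hx'.le hy'.le]
  calc (x : ℝ) ^ c / (((x + y : ℕ) : ℝ) ^ s.re * ((x + y : ℕ) : ℝ) ^ c)
      ≤ ((x + y : ℕ) : ℝ) ^ c / (((x + y : ℕ) : ℝ) ^ s.re * ((x + y : ℕ) : ℝ) ^ c) := by
        gcongr
        lia
    _ = (((x + y : ℕ) : ℝ) ^ 2) ^ (-(s.re / 2)) := by
        rw [← Real.rpow_natCast _ 2, ← Real.rpow_mul hxy.le]
        rw [show ((2 : ℕ) : ℝ) * -(s.re / 2) = -s.re by push_cast; ring, Real.rpow_neg hxy.le]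
        field_simp
    _ ≤ ((x : ℝ) * y) ^ (-(s.re / 2)) := by
        apply Real.rpow_le_rpow_of_nonpos (by positivity) _ (by linarith)
        push_cast
        nlinarith

lemma summable_pow_div_add_cpow (c : ℕ) {s : ℂ} (hs : 2 < s.re) :
    Summable fun p : ℕ × ℕ ↦
      ((p.1 + 1 : ℕ) : ℂ) ^ c / ((p.1 + 1 + (p.2 + 1) : ℕ) : ℂ) ^ (s + (c : ℂ)) := by
  have h : Summable fun n : ℕ ↦ ((n + 1 : ℕ) : ℝ) ^ (-(s.re / 2)) :=
    (summable_nat_add_iff 1).mpr (Real.summable_nat_rpow.mpr (by linarith))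
  refine Summable.of_norm_bounded (h.mul_of_nonneg h (fun _ ↦ by positivity)
    (fun _ ↦ by positivity)) fun p ↦ ?_
  exact norm_pow_div_add_cpow_le c (by linarith) p.1.succ_pos p.2.succ_pos

lemma hasSum_Z (c : ℕ) {s : ℂ} (hs : 2 < s.re) :
    HasSum (fun p : ℕ × ℕ ↦
      ((p.1 + 1 : ℕ) : ℂ) ^ c / ((p.1 + 1 + (p.2 + 1) : ℕ) : ℂ) ^ (s + (c : ℂ))) (Z c s) := by
  convert! (summable_pow_div_add_cpow c hs).hasSum using 1
  rw [Z, ← (Equiv.prodCongr Equiv.pnatEquivNat Equiv.pnatEquivNat).symm.tsum_eq]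
  rfl

open Finset in
lemma lseriesHasSum_zCoeff (c : ℕ) {s : ℂ} (hs : 2 < s.re) :
    LSeriesHasSum (zCoeff c) s (Z c s) := by
  have h := ((HasAntidiagonal.sigmaAntidiagonalEquivProd (A := ℕ)).hasSum_iff.mpr
    (hasSum_Z c hs)).sigma fun n ↦ hasSum_fintype _
  rw [LSeriesHasSum, ← hasSum_nat_add_iff' 2]
  convert! h using 1
  · ext n
    have hn : ((n + 2 : ℕ) : ℂ) ≠ 0 := by exact_mod_cast (n + 1).succ_ne_zero
    rw [LSeries.term_of_ne_zero (by lia), zCoeff, div_div, sum_div, sum_Ico_eq_sum_range]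
    simp only [Function.comp_def, HasAntidiagonal.sigmaAntidiagonalEquivProd_apply]
    rw [sum_coe_sort (antidiagonal n) fun p : ℕ × ℕ ↦
      ((p.1 + 1 : ℕ) : ℂ) ^ c / ((p.1 + 1 + (p.2 + 1) : ℕ) : ℂ) ^ (s + (c : ℂ)),
      Nat.sum_antidiagonal_eq_sum_range_succ_mk]
    refine sum_congr rfl fun i hi ↦ ?_
    have hi' : i ≤ n := by simpa [Nat.lt_succ_iff] using hi
    rw [show i + 1 + (n - i + 1) = n + 2 by lia, Complex.cpow_add _ _ hn, Complex.cpow_natCast,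
      mul_comm ((n + 2 : ℕ) ^ c : ℂ), add_comm 1 i]
  · simp [sum_range_succ, LSeries.term_def, zCoeff]

/-- A Dirichlet series converging absolutely to `0` on a half-plane has zero coefficients. -/
lemma eq_zero_of_forall_lseriesHasSum_zero {f : ℕ → ℂ} {x : ℝ}
    (h : ∀ s : ℂ, x < s.re → LSeriesHasSum f s 0) {n : ℕ} (hn : n ≠ 0) : f n = 0 := by
  have hx : ∀ y : ℝ, x < y → LSeriesHasSum f y 0 := fun y hy ↦ h y (by simpa using hy)
  refine (LSeries_eventually_eq_zero_iff'.mp ?_).resolve_right ?_ n hn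
  · filter_upwards [Filter.eventually_gt_atTop x] with y hy using (hx y hy).LSeries_eq
  · exact ((hx (x + 1) (by linarith)).LSeriesSummable.abscissaOfAbsConv_le.trans_lt
      (EReal.coe_lt_top _)).ne

lemma zCoeff_relation {m : ℕ} {c : ℕ → ℂ}
    (h : ∀ s : ℂ, 2 < s.re →
      Z (2 * m + 1) s + (∑ k ∈ Finset.Icc 1 m, c (2 * k) * Z (2 * k) s) +
        c 0 * Z 0 s / 2 = 0) {N : ℕ} (hN : N ≠ 0) :
    zCoeff (2 * m + 1) N + (∑ k ∈ Finset.Icc 1 m, c (2 * k) * zCoeff (2 * k) N) +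
      c 0 / 2 * zCoeff 0 N = 0 := by
  have := eq_zero_of_forall_lseriesHasSum_zero (x := 2)
    (f := zCoeff (2 * m + 1) + (∑ k ∈ Finset.Icc 1 m, c (2 * k) • zCoeff (2 * k)) +
      (c 0 / 2) • zCoeff 0) (fun s hs ↦ ?_) hN
  · simpa using this
  · rw [← h s hs, mul_div_right_comm]
    exact ((lseriesHasSum_zCoeff _ hs).add
      (.sum fun k _ ↦ (lseriesHasSum_zCoeff _ hs).smul _)).add ((lseriesHasSum_zCoeff _ hs).smul _)

open Finset in
/-- The polynomial with value `∑ k < N, k ^ p` at each natural number `N`. -/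
noncomputable def faulhaber (p : ℕ) : Polynomial ℂ :=
  ∑ i ∈ range (p + 1),
    Polynomial.monomial (p + 1 - i) ((bernoulli i * (p + 1).choose i / (p + 1) : ℚ) : ℂ)

lemma eval_faulhaber (p N : ℕ) :
    (faulhaber p).eval (N : ℂ) = ∑ k ∈ Finset.range N, (k : ℂ) ^ p := by
  have h := congrArg (fun q : ℚ ↦ (q : ℂ)) (sum_range_pow N p)
  push_cast at h
  rw [h, faulhaber, Polynomial.eval_finsetSum]
  refine Finset.sum_congr rfl fun i _ ↦ ?_
  rw [Polynomial.eval_monomial]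
  push_cast
  ring

lemma coeff_faulhaber {p i : ℕ} (hi : i ≤ p) :
    (faulhaber p).coeff (p + 1 - i) =
      ((bernoulli i * (p + 1).choose i / (p + 1) : ℚ) : ℂ) := by
  rw [faulhaber, Polynomial.finsetSum_coeff, Finset.sum_eq_single_of_mem i (by simp; lia)]
  · simp
  · intro j hj hji
    rw [Finset.mem_range] at hj
    rw [Polynomial.coeff_monomial, if_neg (by lia)]

lemma coeff_one_faulhaber (p : ℕ) : (faulhaber p).coeff 1 = (bernoulli p : ℂ) := by
  have h := coeff_faulhaber (le_refl p)
  have hp : (p + 1 : ℂ) ≠ 0 := by exact_mod_cast p.succ_ne_zero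
  rw [Nat.add_sub_cancel_left, Nat.choose_succ_self_right] at h
  rw [h]
  push_cast
  field_simp

lemma coeff_two_faulhaber (q : ℕ) :
    (faulhaber (q + 1)).coeff 2 = (bernoulli q : ℂ) * (q + 1) / 2 := by
  have h := coeff_faulhaber q.le_succ
  have hq : (q + 1 + 1 : ℂ) ≠ 0 := by exact_mod_cast (q + 1).succ_ne_zero
  rw [show q + 1 + 1 - q = 2 by lia, Nat.succ_eq_add_one,
    ← Nat.choose_symm_of_eq_add (show q + 1 + 1 = 2 + q by lia)] at h
  rw [h]
  push_cast [Nat.cast_choose_two]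
  field_simp
  ring

lemma zCoeff_zero_left {N : ℕ} (hN : N ≠ 0) : zCoeff 0 N = N - 1 := by
  simp [zCoeff, Nat.cast_sub (Nat.one_le_iff_ne_zero.mpr hN)]

lemma eval_faulhaber_eq_zCoeff_mul {p N : ℕ} (hp : p ≠ 0) (hN : N ≠ 0) :
    (faulhaber p).eval (N : ℂ) = zCoeff p N * (N : ℂ) ^ p := by
  have hN' : (N : ℂ) ≠ 0 := by exact_mod_cast hN
  rw [eval_faulhaber, zCoeff, div_mul_cancel₀ _ (pow_ne_zero _ hN'), Finset.range_eq_Ico,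
    Finset.sum_eq_sum_Ico_succ_bot (Nat.pos_of_ne_zero hN)]
  simp [hp]

lemma bernoulli_two_mul_ne_zero {k : ℕ} (hk : k ≠ 0) : bernoulli (2 * k) ≠ 0 := by
  intro h
  have hs := hasSum_zeta_nat hk
  simp only [h, Rat.cast_zero, mul_zero, zero_div] at hs
  have := (hasSum_zero_iff_of_nonneg fun n ↦ by positivity).mp hs
  simpa using congrFun this 1

open Polynomial in
lemma coeff_top_of_zCoeff_relation {m : ℕ} (hm : m ≠ 0) {α : ℂ} {c : ℕ → ℂ}
    (h : ∀ N : ℕ, N ≠ 0 →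
      α * zCoeff (2 * m + 1) N + (∑ k ∈ Finset.Icc 1 m, c (2 * k) * zCoeff (2 * k) N) +
        c 0 / 2 * zCoeff 0 N = 0) :
    c (2 * m) = -α * (2 * (m : ℂ) + 1) / 2 := by
  set P : ℂ[X] := C α * faulhaber (2 * m + 1) +
    (∑ k ∈ Finset.Icc 1 m, C (c (2 * k)) * (faulhaber (2 * k) * X ^ (2 * m + 1 - 2 * k))) +
    C (c 0 / 2) * ((X - 1) * X ^ (2 * m + 1)) with hP
  have hP0 : P = 0 := by
    refine eq_zero_of_infinite_isRoot P (((Set.infinite_of_not_bddAbove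
      (not_bddAbove_Ioi 0)).image Nat.cast_injective.injOn).mono ?_ :
        Set.Infinite {x : ℂ | P.IsRoot x})
    rintro _ ⟨N, hN, rfl⟩
    have hN0 : N ≠ 0 := (Set.mem_Ioi.mp hN).ne'
    have hsum : ∑ k ∈ Finset.Icc 1 m,
        c (2 * k) * ((faulhaber (2 * k)).eval (N : ℂ) * (N : ℂ) ^ (2 * m + 1 - 2 * k)) =
        (∑ k ∈ Finset.Icc 1 m, c (2 * k) * zCoeff (2 * k) N) * (N : ℂ) ^ (2 * m + 1) := by
      rw [Finset.sum_mul]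
      refine Finset.sum_congr rfl fun k hk ↦ ?_
      rw [Finset.mem_Icc] at hk
      rw [eval_faulhaber_eq_zCoeff_mul (by lia) hN0, mul_assoc (zCoeff _ _), ← pow_add,
        show 2 * k + (2 * m + 1 - 2 * k) = 2 * m + 1 by lia, mul_assoc]
    change P.eval (N : ℂ) = 0
    rw [hP]
    simp only [eval_add, eval_mul, eval_C, eval_finsetSum, eval_pow, eval_X, eval_sub, eval_one]
    rw [hsum, eval_faulhaber_eq_zCoeff_mul (by lia) hN0, ← zCoeff_zero_left hN0]
    linear_combination (N : ℂ) ^ (2 * m + 1) * h N hN0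
  have hcoeff : ∑ k ∈ Finset.Icc 1 m,
      c (2 * k) * (faulhaber (2 * k) * X ^ (2 * m + 1 - 2 * k)).coeff 2 =
      c (2 * m) * _root_.bernoulli (2 * m) := by
    rw [Finset.sum_eq_single_of_mem m (by simp; lia)]
    · rw [show 2 * m + 1 - 2 * m = 1 by lia, coeff_mul_X_pow', if_pos (by lia),
        show 2 - 1 = 1 from rfl, coeff_one_faulhaber]
    · intro k hk hkm
      rw [Finset.mem_Icc] at hk
      rw [coeff_mul_X_pow', if_neg (by lia), mul_zero]
  have h2 : P.coeff 2 = 0 := by rw [hP0, coeff_zero]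
  rw [hP] at h2
  simp only [coeff_add, coeff_C_mul, finsetSum_coeff] at h2
  rw [hcoeff, coeff_two_faulhaber, coeff_mul_X_pow', if_neg (by lia)] at h2
  have hB : (_root_.bernoulli (2 * m) : ℂ) ≠ 0 := by exact_mod_cast bernoulli_two_mul_ne_zero hm
  push_cast at h2
  apply mul_right_cancel₀ hB
  linear_combination h2

/-- The coefficient sequences of `Z 0, Z 2, …, Z (2 * m)` are linearly independent. -/
lemma eq_zero_of_zCoeff_relation {m : ℕ} {c : ℕ → ℂ}
    (h : ∀ N : ℕ, N ≠ 0 → (∑ k ∈ Finset.Icc 1 m, c (2 * k) * zCoeff (2 * k) N) +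
      c 0 / 2 * zCoeff 0 N = 0) : ∀ k ≤ m, c (2 * k) = 0 := by
  induction m with
  | zero =>
    intro k hk
    have h2 := h 2 two_ne_zero
    rw [zCoeff_zero_left two_ne_zero] at h2
    norm_num at h2
    simpa [Nat.le_zero.mp hk] using h2
  | succ m ih =>
    have htop : c (2 * (m + 1)) = 0 := by
      simpa using coeff_top_of_zCoeff_relation m.succ_ne_zero (α := 0) (c := c)
        fun N hN ↦ by simpa using h N hN
    intro k hk
    rcases hk.lt_or_eq with hk | rfl
    · refine ih (fun N hN ↦ ?_) k (Nat.lt_succ_iff.mp hk)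
      simpa [Finset.sum_Icc_succ_top (show 1 ≤ m + 1 by lia), htop] using h N hN
    · exact htop

/-- If complex numbers `c_0, c_2, …, c_{2m}` satisfy
`Z_{2m+1}(s) + c_{2m} Z_{2m}(s) + c_{2m-2} Z_{2m-2}(s) + ⋯ + c_2 Z_2(s) + c_0 Z_0(s)/2 = 0`
for all `s` with `Re s > 2`, then they are uniquely determined; moreover, if `m ≥ 1` then
`c_{2m} = -(2m+1)/2`. -/
theorem coeffs_unique (m : ℕ) :
    (∀ c c' : ℕ → ℂ,
      (∀ s : ℂ, 2 < s.re →
        Z (2 * m + 1) s + (∑ k ∈ Finset.Icc 1 m, c (2 * k) * Z (2 * k) s) +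
          c 0 * Z 0 s / 2 = 0) →
      (∀ s : ℂ, 2 < s.re →
        Z (2 * m + 1) s + (∑ k ∈ Finset.Icc 1 m, c' (2 * k) * Z (2 * k) s) +
          c' 0 * Z 0 s / 2 = 0) →
      ∀ k ≤ m, c (2 * k) = c' (2 * k)) ∧
    (∀ c : ℕ → ℂ,
      (∀ s : ℂ, 2 < s.re →
        Z (2 * m + 1) s + (∑ k ∈ Finset.Icc 1 m, c (2 * k) * Z (2 * k) s) +
          c 0 * Z 0 s / 2 = 0) →
      1 ≤ m → c (2 * m) = -(2 * (m : ℂ) + 1) / 2) := by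
  refine ⟨fun c c' h h' k hk ↦ ?_, fun c h hm ↦ ?_⟩
  · refine sub_eq_zero.mp (eq_zero_of_zCoeff_relation (m := m) (c := c - c')
      (fun N hN ↦ ?_) k hk)
    simp only [Pi.sub_apply, sub_mul, Finset.sum_sub_distrib, sub_div]
    linear_combination zCoeff_relation h hN - zCoeff_relation h' hN
  · rw [coeff_top_of_zCoeff_relation (α := 1) (c := c) (by lia : m ≠ 0)
      fun N hN ↦ by simpa using zCoeff_relation h hN]
    ring
end

section
/- For every complex number s with Re(s) > 2, one has Z_5(s) = (5/2)·Z_4(s) − (5/2)·Z_2(s) + (1/2)·Z_0(s). -/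
/-- The double series `∑ (m+n)^(-σ)` converges for `σ > 2`, by comparison with
`∑ m^(-σ/2) n^(-σ/2)`. -/
theorem summable_pnat_add_rpow_neg {σ : ℝ} (hσ : 2 < σ) :
    Summable fun p : ℕ+ × ℕ+ => (((p.1 : ℕ) : ℝ) + ((p.2 : ℕ) : ℝ)) ^ (-σ) := by
  have h1 : Summable fun n : ℕ+ => ((n : ℕ) : ℝ) ^ (-(σ / 2)) :=
    (Real.summable_nat_rpow.2 (by linarith)).comp_injective PNat.coe_injective
  have h2 := h1.mul_of_nonneg h1 (fun n => by positivity) (fun n => by positivity)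
  refine Summable.of_nonneg_of_le (fun p => by positivity) (fun p => ?_) h2
  have ha : (0 : ℝ) < ((p.1 : ℕ) : ℝ) := by exact_mod_cast p.1.pos
  have hb : (0 : ℝ) < ((p.2 : ℕ) : ℝ) := by exact_mod_cast p.2.pos
  have hsplit : (((p.1 : ℕ) : ℝ) + ((p.2 : ℕ) : ℝ)) ^ (-σ) =
      (((p.1 : ℕ) : ℝ) + ((p.2 : ℕ) : ℝ)) ^ (-(σ / 2)) *
        (((p.1 : ℕ) : ℝ) + ((p.2 : ℕ) : ℝ)) ^ (-(σ / 2)) := by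
    rw [← Real.rpow_add (by positivity)]
    ring_nf
  rw [hsplit]
  exact mul_le_mul
    (Real.rpow_le_rpow_of_nonpos ha (by linarith) (by linarith))
    (Real.rpow_le_rpow_of_nonpos hb (by linarith) (by linarith))
    (by positivity) (by positivity)

/-- The terms of `Z c s` rewritten as `(m/(m+n))^c (m+n)^(-s)`. -/
theorem Z_term_eq (c : ℕ) (s : ℂ) (p : ℕ+ × ℕ+) :
    ((p.1 : ℕ) : ℂ) ^ c / ((((p.1 : ℕ) + (p.2 : ℕ) : ℕ)) : ℂ) ^ (s + (c : ℂ)) =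
      (((p.1 : ℕ) : ℂ) / ((((p.1 : ℕ) + (p.2 : ℕ) : ℕ)) : ℂ)) ^ c *
        ((((p.1 : ℕ) + (p.2 : ℕ) : ℕ)) : ℂ) ^ (-s) := by
  have hN : ((((p.1 : ℕ) + (p.2 : ℕ) : ℕ)) : ℂ) ≠ 0 :=
    Nat.cast_ne_zero.2 (Nat.add_pos_left p.1.pos _).ne'
  rw [Complex.cpow_add _ _ hN, Complex.cpow_natCast, Complex.cpow_neg, div_pow, ← div_eq_mul_inv, div_div, mul_comm]

theorem summable_Z_term (c : ℕ) {s : ℂ} (hs : 2 < s.re) :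
    Summable fun p : ℕ+ × ℕ+ =>
      (((p.1 : ℕ) : ℂ) / ((((p.1 : ℕ) + (p.2 : ℕ) : ℕ)) : ℂ)) ^ c *
        ((((p.1 : ℕ) + (p.2 : ℕ) : ℕ)) : ℂ) ^ (-s) := by
  refine Summable.of_norm_bounded (summable_pnat_add_rpow_neg hs) fun p => ?_
  have hpos : 0 < (p.1 : ℕ) + (p.2 : ℕ) := Nat.add_pos_left p.1.pos _
  rw [norm_mul, norm_pow, norm_div, Complex.norm_natCast, Complex.norm_natCast,
    Complex.norm_natCast_cpow_of_pos hpos, Complex.neg_re, Nat.cast_add]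
  refine mul_le_of_le_one_left (by positivity) (pow_le_one₀ (by positivity) ?_)
  exact div_le_one_of_le₀ (le_add_of_nonneg_right (by positivity)) (by positivity)

theorem zeta_neg_five_relation (s : ℂ) (hs : 2 < s.re) :
    Z 5 s = (5 / 2) * Z 4 s - (5 / 2) * Z 2 s + (1 / 2) * Z 0 s := by
  simp only [Z, Z_term_eq]
  have h5 := (summable_Z_term 5 hs).hasSum
  have h4 := ((summable_Z_term 4 hs).hasSum).mul_left (5 / 2)
  have h2 := ((summable_Z_term 2 hs).hasSum).mul_left (5 / 2)
  have h0 := ((summable_Z_term 0 hs).hasSum).mul_left (1 / 2)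
  have h := h5.sub ((h4.sub h2).add h0)
  have hswap := (Equiv.prodComm ℕ+ ℕ+).hasSum_iff.2 h
  have hzero := (h.add hswap).unique (hasSum_zero.congr_fun ?_)
  · linear_combination hzero / 2
  · intro p
    have hN : (((p.1 : ℕ) : ℂ) + ((p.2 : ℕ) : ℂ)) ≠ 0 := by
      exact_mod_cast (Nat.add_pos_left p.1.pos _).ne'
    have hx : ((p.2 : ℕ) : ℂ) / (((p.1 : ℕ) : ℂ) + ((p.2 : ℕ) : ℂ)) =
        1 - ((p.1 : ℕ) : ℂ) / (((p.1 : ℕ) : ℂ) + ((p.2 : ℕ) : ℂ)) := by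
      field_simp
      ring
    simp only [Function.comp_apply, Equiv.prodComm_apply, Prod.fst_swap, Prod.snd_swap,
      Nat.cast_add, add_comm ((p.2 : ℕ) : ℂ), hx]
    ring
end
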